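/- arXiv:2412.15794 — 2 statements merged into one kernel-verified Lean document; each statement's English description precedes it below -/
import Mathlib

section
/- Let X be a compact metric space whose Nagata dimension is at most n with constant c > 0, isometrically embedded in the space ℓ^∞ of bounded real sequences with the supremum norm. Then there exists a constant C > 0, depending only on n and c, such that for every ε > 0 there exist a finite simplicial complex Σ of dimension at most n, with side length ε and equipped with the ℓ²-metric, and maps φ : X → Σ and ψ : Σ → ℓ^∞ with the following properties: (1) φ is C-Lipschitz and the restriction of ψ to each simplex of Σ is C-Lipschitz; (2) every simplex of Σ is contained in the smallest simplex of Σ containing φ(x) for some x ∈ X (that is, the hull of φ(X), the smallest subcomplex of Σ containing φ(X), equals Σ); (3) ‖x − ψ(φ(x))‖_∞ ≤ C·ε for every x ∈ X. -/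
open Set MeasureTheory Metric Filter
open scoped NNReal ENNReal Pointwise

noncomputable section

/-- The space ℓ^∞ of bounded real sequences with the supremum norm. -/
abbrev Linf : Type := lp (fun _ : ℕ => ℝ) ⊤

/-- Nagata dimension of `X` is at most `n` with constant `c`: for every `s > 0` there is
a covering of `X` by sets of diameter at most `c·s` such that every set of diameter
less than `s` meets at most `n+1` members of the covering. -/
def NagataDimLE (X : Type*) [MetricSpace X] (n : ℕ) (c : ℝ) : Prop :=
  ∀ s : ℝ, 0 < s → ∃ 𝒰 : Set (Set X),
    (⋃₀ 𝒰 = Set.univ) ∧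
    (∀ U ∈ 𝒰, EMetric.diam U ≤ ENNReal.ofReal (c * s)) ∧
    (∀ A : Set X, EMetric.diam A < ENNReal.ofReal s →
      ({U ∈ 𝒰 | (A ∩ U).Nonempty}).Finite ∧
      ({U ∈ 𝒰 | (A ∩ U).Nonempty}).ncard ≤ n + 1)

/-- An abstract finite simplicial complex on vertex set `I`:
a nonempty family of nonempty finite subsets of `I`, closed under nonempty subsets. -/
structure SimplicialCplx (I : Type*) where
  F : Finset (Finset I)
  F_nonempty : F.Nonempty
  mem_nonempty : ∀ S ∈ F, S.Nonempty
  down_closed : ∀ S ∈ F, ∀ T : Finset I, T ⊆ S → T.Nonempty → T ∈ F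

/-- The vertex `e_i` of the standard simplex in the Euclidean space `ℝ^I`. -/
def vertex {I : Type*} [Fintype I] [DecidableEq I] (i : I) : EuclideanSpace ℝ I :=
  EuclideanSpace.single i (1 : ℝ)

/-- The closed simplex `Δ_S = (ε/√2) · convexHull {e_i : i ∈ S}`,
a Euclidean simplex of side length `ε`. -/
def simplexOf {I : Type*} [Fintype I] [DecidableEq I] (ε : ℝ) (S : Finset I) :
    Set (EuclideanSpace ℝ I) :=
  (ε / Real.sqrt 2) • convexHull ℝ (vertex '' (S : Set I))

/-- The geometric realization of a simplicial complex with side length `ε`,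
as a subset of the Euclidean space `ℝ^I` (carrying the `ℓ²`-metric). -/
def realization {I : Type*} [Fintype I] [DecidableEq I] (ε : ℝ) (K : SimplicialCplx I) :
    Set (EuclideanSpace ℝ I) :=
  ⋃ S ∈ K.F, simplexOf ε S

/-- The `k`-skeleton of the realization: the union of the simplices on at most
`k+1` vertices. -/
def skeleton {I : Type*} [Fintype I] [DecidableEq I] (ε : ℝ) (K : SimplicialCplx I) (k : ℕ) :
    Set (EuclideanSpace ℝ I) :=
  ⋃ S ∈ K.F, ⋃ (_ : S.card ≤ k + 1), simplexOf ε S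

/-- The relative interior of the simplex with vertex set `S` (side length `ε`). -/
def openSimplexOf {I : Type*} [Fintype I] [DecidableEq I] (ε : ℝ) (S : Finset I) :
    Set (EuclideanSpace ℝ I) :=
  {x | ∃ t : I → ℝ, (∀ i ∈ S, 0 < t i) ∧ (∑ i ∈ S, t i) = 1 ∧
    x = (ε / Real.sqrt 2) • ∑ i ∈ S, t i • vertex i}

/-- The open star of the simplex with vertex set `S`: the union of the relative
interiors of the simplices of `K` having `S` as a face. -/
def openStar {I : Type*} [Fintype I] [DecidableEq I] (ε : ℝ) (K : SimplicialCplx I)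
    (S : Finset I) : Set (EuclideanSpace ℝ I) :=
  ⋃ T ∈ K.F, ⋃ (_ : S ⊆ T), openSimplexOf ε T

/-- `P` is purely `n`-unrectifiable: every Lipschitz image of a subset of `ℝⁿ`
meets `P` in a set of Hausdorff `n`-measure zero. -/
def PurelyUnrectifiable (n : ℕ) {X : Type*} [MetricSpace X] [MeasurableSpace X] [BorelSpace X]
    (P : Set X) : Prop :=
  ∀ (A : Set (EuclideanSpace ℝ (Fin n))) (φ : EuclideanSpace ℝ (Fin n) → X) (L : ℝ≥0),
    LipschitzOnWith L φ A → μH[(n : ℝ)] (P ∩ φ '' A) = 0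

theorem mem_simplexOf_of_weights {I : Type*} [Fintype I] [DecidableEq I] (ε : ℝ) (S : Finset I)
    (t : I → ℝ) (ht : ∀ i, 0 ≤ t i) (hS : ∀ i, i ∉ S → t i = 0) (hsum : ∑ i, t i = 1) :
    WithLp.toLp 2 (fun i => ε / Real.sqrt 2 * t i) ∈ simplexOf ε S := by
  have hsub : ∑ i ∈ S, t i = 1 := by
    rw [← hsum]
    exact Finset.sum_subset (Finset.subset_univ S) fun i _ hi => hS i hi
  refine Set.mem_smul_set.mpr ⟨∑ i ∈ S, t i • vertex i, ?_, ?_⟩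
  · exact (convex_convexHull ℝ _).sum_mem (fun i _ => ht i) hsub
      fun i hi => subset_convexHull ℝ _ ⟨i, hi, rfl⟩
  · ext j
    by_cases hj : j ∈ S
    · simp [vertex, Pi.single_apply, hj]
    · simp [vertex, Pi.single_apply, hj, hS j hj]

theorem apply_eq_zero_and_sum_of_mem_simplexOf {I : Type*} [Fintype I] [DecidableEq I] {ε : ℝ}
    {S : Finset I} {v : EuclideanSpace ℝ I} (hv : v ∈ simplexOf ε S) :
    (∀ i, i ∉ S → v i = 0) ∧ ∑ i, v i = ε / Real.sqrt 2 := by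
  obtain ⟨w, hw, rfl⟩ := Set.mem_smul_set.mp hv
  have hw' : w ∈ {w : EuclideanSpace ℝ I | (∀ i, i ∉ S → w i = 0) ∧ ∑ i, w i = 1} := by
    refine convexHull_min ?_ ?_ hw
    · rintro _ ⟨i, hi, rfl⟩
      refine ⟨fun j hj => ?_, by simp [vertex]⟩
      have : j ≠ i := fun h => hj (h ▸ hi)
      simp [vertex, this]
    · intro x hx y hy a b _ _ hab
      refine ⟨fun i hi => by simp [hx.1 i hi, hy.1 i hi], ?_⟩
      simp [Finset.sum_add_distrib, ← Finset.mul_sum, hx.2, hy.2, hab]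
  refine ⟨fun i hi => by simp [hw'.1 i hi], ?_⟩
  simp [← Finset.mul_sum, hw'.2]

theorem EuclideanSpace.norm_le_sum_abs {I : Type*} [Fintype I] (v : EuclideanSpace ℝ I) :
    ‖v‖ ≤ ∑ i, |v i| := by
  rw [EuclideanSpace.norm_eq]
  refine Real.sqrt_le_iff.mpr ⟨Finset.sum_nonneg fun i _ => abs_nonneg _, ?_⟩
  simpa using Finset.sum_sq_le_sq_sum_of_nonneg (s := Finset.univ) (f := fun i => |v i|)
    fun i _ => abs_nonneg _

/-- A finite family of bump functions subordinate to a covering as in the definition of Nagata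
dimension, at scale `ε`. -/
theorem NagataDimLE.exists_bump_functions {X : Type*} [MetricSpace X] [CompactSpace X] {n : ℕ}
    {c : ℝ} (hc : 0 < c) (hX : NagataDimLE X n c) {ε : ℝ} (hε : 0 < ε) :
    ∃ (m : ℕ) (p : Fin m → X) (f : Fin m → X → ℝ),
      (∀ i x, 0 ≤ f i x) ∧
      (∀ i x y, |f i x - f i y| ≤ dist x y) ∧
      (∀ i x, f i x ≠ 0 → dist x (p i) ≤ (1 + 4 * c) * ε) ∧
      (∀ x, (Finset.univ.filter fun i => f i x ≠ 0).card ≤ n + 1) ∧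
      (∀ x, ∃ i, ε ≤ f i x) := by
  obtain ⟨𝒰, hcov, hdiam, hmult⟩ := hX (4 * ε) (by positivity)
  have hball : ∀ x : X, Metric.ediam (Metric.ball x ε) < ENNReal.ofReal (4 * ε) := by
    intro x
    have h1 : Metric.ediam (Metric.ball x ε) ≤ 2 * ENNReal.ofReal ε := by
      rw [← Metric.eball_ofReal]
      exact Metric.ediam_eball_le
    refine h1.trans_lt ?_
    rw [show (2 : ℝ≥0∞) = ENNReal.ofReal 2 by simp, ← ENNReal.ofReal_mul (by norm_num)]
    exact (ENNReal.ofReal_lt_ofReal_iff (by positivity)).mpr (by linarith)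
  let V : Set (Set X) := {U ∈ 𝒰 | U.Nonempty}
  have hV : V.Finite := by
    obtain ⟨t, ht, htc⟩ := Metric.totallyBounded_iff.mp
      (isCompact_univ (X := X)).totallyBounded ε hε
    refine (ht.biUnion fun x _ => (hmult _ (hball x)).1).subset ?_
    rintro U ⟨hU, y, hy⟩
    obtain ⟨x, hx, hyx⟩ := Set.mem_iUnion₂.mp (htc (Set.mem_univ y))
    exact Set.mem_iUnion₂.mpr ⟨x, hx, hU, y, hyx, hy⟩
  have : Finite V := hV
  obtain ⟨m, ⟨e⟩⟩ := Finite.exists_equiv_fin V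
  have hne : ∀ i, ((e.symm i : V) : Set X).Nonempty := fun i => (e.symm i).2.2
  choose p hp using hne
  have near : ∀ i x, max 0 (ε - Metric.infDist x (e.symm i : Set X)) ≠ 0 →
      ∃ y ∈ (e.symm i : Set X), dist x y < ε := by
    intro i x h
    refine (Metric.infDist_lt_iff ⟨p i, hp i⟩).mp ?_
    by_contra! hle
    exact h (max_eq_left (by linarith))
  refine ⟨m, p, fun i x => max 0 (ε - Metric.infDist x (e.symm i : Set X)),
    fun i x => le_max_left _ _, fun i x y => ?_, fun i x h => ?_, fun x => ?_, fun x => ?_⟩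
  · refine (abs_max_sub_max_le_max _ _ _ _).trans ?_
    have h := (Metric.lipschitz_infDist_pt (e.symm i : Set X)).dist_le_mul x y
    rw [Real.dist_eq, abs_sub_comm] at h
    simpa using h
  · obtain ⟨y, hy, hxy⟩ := near i x h
    have hd : dist y (p i) ≤ c * (4 * ε) := by
      have h1 := (Metric.edist_le_ediam_of_mem hy (hp i)).trans (hdiam _ (e.symm i).2.1)
      rw [edist_dist] at h1
      exact (ENNReal.ofReal_le_ofReal_iff (by positivity)).mp h1
    linarith [dist_triangle x y (p i)]
  · obtain ⟨hfin, hcard⟩ := hmult _ (hball x)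
    refine le_trans ?_ hcard
    rw [← Set.ncard_coe_finset]
    refine Set.ncard_le_ncard_of_injOn (fun i => (e.symm i : Set X)) ?_ ?_ hfin
    · intro i hi
      obtain ⟨y, hy, hxy⟩ := near i x (by simpa using hi)
      exact ⟨(e.symm i).2.1, y, by rwa [Metric.mem_ball, dist_comm], hy⟩
    · intro i _ j _ hij
      exact e.symm.injective (Subtype.ext hij)
  · obtain ⟨U, hU, hx⟩ := Set.mem_sUnion.mp (hcov ▸ Set.mem_univ x : x ∈ ⋃₀ 𝒰)
    refine ⟨e ⟨U, hU, x, hx⟩, ?_⟩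
    simp [Metric.infDist_zero_of_mem hx]

theorem sum_abs_sub_le_of_card_support_le {ι X : Type*} [Fintype ι] [PseudoMetricSpace X]
    {f : ι → X → ℝ} {N : ℕ} (hf : ∀ i x y, |f i x - f i y| ≤ dist x y)
    (hN : ∀ x, (Finset.univ.filter fun i => f i x ≠ 0).card ≤ N) (x y : X) :
    ∑ i, |f i x - f i y| ≤ 2 * N * dist x y := by
  classical
  set A := (Finset.univ.filter fun i => f i x ≠ 0) ∪ Finset.univ.filter fun i => f i y ≠ 0
  have hA : (A.card : ℝ) ≤ 2 * N := by
    have := (Finset.card_union_le _ _).trans (add_le_add (hN x) (hN y))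
    have h2 : A.card ≤ 2 * N := by rw [two_mul]; exact this
    exact_mod_cast h2
  calc ∑ i, |f i x - f i y| = ∑ i ∈ A, |f i x - f i y| := by
        refine (Finset.sum_subset (Finset.subset_univ A) fun i _ hi => ?_).symm
        have h : f i x = 0 ∧ f i y = 0 := by simpa [A] using hi
        simp [h.1, h.2]
    _ ≤ A.card • dist x y := Finset.sum_le_card_nsmul _ _ _ fun i _ => hf i x y
    _ ≤ 2 * N * dist x y := by
        rw [nsmul_eq_mul]
        exact mul_le_mul_of_nonneg_right hA dist_nonneg

theorem sum_abs_div_sum_sub_le {ι : Type*} [Fintype ι] {a b : ι → ℝ} {r : ℝ} (hr : 0 < r)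
    (hb : ∀ i, 0 ≤ b i) (hra : r ≤ ∑ i, a i) (hrb : r ≤ ∑ i, b i) :
    ∑ i, |a i / ∑ j, a j - b i / ∑ j, b j| ≤ 2 * (∑ i, |a i - b i|) / r := by
  set A := ∑ j, a j
  set B := ∑ j, b j
  have hA : 0 < A := hr.trans_le hra
  have hB : 0 < B := hr.trans_le hrb
  have hBA : |B - A| ≤ ∑ i, |a i - b i| := by
    rw [abs_sub_comm, ← Finset.sum_sub_distrib]
    exact Finset.abs_sum_le_sum_abs _ _
  calc ∑ i, |a i / A - b i / B| ≤ ∑ i, (|a i - b i| / A + b i / B * (|B - A| / A)) := by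
        refine Finset.sum_le_sum fun i _ => ?_
        have h : a i / A - b i / B = (a i - b i) / A + b i / B * ((B - A) / A) := by
          field_simp
          ring
        rw [h]
        refine (abs_add_le _ _).trans_eq ?_
        rw [abs_mul, abs_div, abs_div (B - A), abs_of_pos hA, abs_of_nonneg (a := b i / B)
          (div_nonneg (hb i) hB.le)]
    _ = (∑ i, |a i - b i| + |B - A|) / A := by
        rw [Finset.sum_add_distrib, ← Finset.sum_div, ← Finset.sum_mul, ← Finset.sum_div,
          div_self hB.ne', one_mul, add_div]
    _ ≤ (2 * ∑ i, |a i - b i|) / A := by gcongr; linarith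
    _ ≤ 2 * (∑ i, |a i - b i|) / r := by
        have : 0 ≤ ∑ i, |a i - b i| := Finset.sum_nonneg fun i _ => abs_nonneg _
        gcongr

theorem norm_sum_smul_le_of_sum_eq_zero {ι E : Type*} [Fintype ι] [SeminormedAddCommGroup E]
    [NormedSpace ℝ E] {S : Finset ι} {a : ι → ℝ} {q : ι → E} {M D : ℝ}
    (hS : ∀ i, i ∉ S → a i = 0) (ha : ∑ i, a i = 0) (hM : ∀ i, |a i| ≤ M)
    (hD : ∀ i ∈ S, ∀ j ∈ S, ‖q i - q j‖ ≤ D) :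
    ‖∑ i, a i • q i‖ ≤ S.card * (M * D) := by
  obtain rfl | ⟨k, hk⟩ := S.eq_empty_or_nonempty
  · simp [hS]
  have h0 : ∑ i, a i • q i = ∑ i ∈ S, a i • (q i - q k) := by
    rw [Finset.sum_subset (Finset.subset_univ S) fun i _ hi => by simp [hS i hi]]
    simp [smul_sub, ← Finset.sum_smul, ha]
  rw [h0, ← nsmul_eq_mul]
  refine (norm_sum_le _ _).trans (Finset.sum_le_card_nsmul _ _ _ fun i hi => ?_)
  rw [norm_smul, Real.norm_eq_abs]
  exact mul_le_mul (hM i) (hD i hi k hk) (norm_nonneg _) ((abs_nonneg _).trans (hM i))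

theorem norm_sub_sum_smul_le {ι E : Type*} [Fintype ι] [SeminormedAddCommGroup E]
    [NormedSpace ℝ E] {t : ι → ℝ} {q : ι → E} {z : E} {D : ℝ} (ht : ∀ i, 0 ≤ t i)
    (hsum : ∑ i, t i = 1) (hD : ∀ i, t i ≠ 0 → ‖z - q i‖ ≤ D) :
    ‖z - ∑ i, t i • q i‖ ≤ D := by
  have h0 : z - ∑ i, t i • q i = ∑ i, t i • (z - q i) := by
    simp [smul_sub, ← Finset.sum_smul, hsum]
  rw [h0]
  calc ‖∑ i, t i • (z - q i)‖ ≤ ∑ i, t i * D := by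
        refine (norm_sum_le _ _).trans (Finset.sum_le_sum fun i _ => ?_)
        rw [norm_smul, Real.norm_eq_abs, abs_of_nonneg (ht i)]
        by_cases h : t i = 0
        · simp [h]
        · exact mul_le_mul_of_nonneg_left (hD i h) (ht i)
    _ = D := by rw [← Finset.sum_mul, hsum, one_mul]

/-- The complex whose simplices are the nonempty subsets of the supports `supp x`. -/
def supportCplx {X I : Type*} [Nonempty X] [Fintype I] [DecidableEq I] (supp : X → Finset I)
    (hne : ∀ x, (supp x).Nonempty) : SimplicialCplx I where
  F := by
    classical exact Finset.univ.filter fun S => S.Nonempty ∧ ∃ x, S ⊆ supp x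
  F_nonempty := by
    obtain ⟨x⟩ := ‹Nonempty X›
    exact ⟨supp x, by simpa using ⟨hne x, x, subset_rfl⟩⟩
  mem_nonempty S hS := by simp at hS; exact hS.1
  down_closed S hS T hTS hT := by
    simp at hS ⊢
    obtain ⟨-, x, hx⟩ := hS
    exact ⟨hT, x, hTS.trans hx⟩

theorem mem_supportCplx {X I : Type*} [Nonempty X] [Fintype I] [DecidableEq I]
    {supp : X → Finset I} {hne : ∀ x, (supp x).Nonempty} {S : Finset I} :
    S ∈ (supportCplx supp hne).F ↔ S.Nonempty ∧ ∃ x, S ⊆ supp x := by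
  simp [supportCplx]

/-- A compact metric space of Nagata dimension at most `n` with constant `c`,
isometrically embedded in `ℓ^∞`, can be approximated at every scale `ε > 0` by a finite
simplicial complex `Σ` of dimension at most `n` and side length `ε`, equipped with the
`ℓ²`-metric, via a `C`-Lipschitz map `φ : X → Σ` with `Hull(φ(X)) = Σ` and a map
`ψ : Σ → ℓ^∞` that is `C`-Lipschitz on each simplex and satisfies `‖x − ψ(φ(x))‖ ≤ C·ε`;
the constant `C` depends only on `n` and `c`. -/
theorem stmt0 (n : ℕ) (c : ℝ) (hc : 0 < c) :
    ∃ C : ℝ≥0, 0 < C ∧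
      ∀ (X : Type) [MetricSpace X] [CompactSpace X] [Nonempty X] (ι : X → Linf),
        Isometry ι → NagataDimLE X n c →
        ∀ ε : ℝ, 0 < ε →
          ∃ (m : ℕ) (K : SimplicialCplx (Fin m))
            (φ : X → EuclideanSpace ℝ (Fin m)) (ψ : EuclideanSpace ℝ (Fin m) → Linf),
            -- `Σ` has dimension at most `n`
            (∀ S ∈ K.F, S.card ≤ n + 1) ∧
            -- `φ` maps into the realization of `Σ` (with side length `ε`)
            (∀ x, φ x ∈ realization ε K) ∧
            -- (1) `φ` is `C`-Lipschitz and `ψ` is `C`-Lipschitz on every simplex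
            LipschitzWith C φ ∧
            (∀ S ∈ K.F, LipschitzOnWith C ψ (simplexOf ε S)) ∧
            -- (2) `Hull(φ(X)) = Σ`: any subcomplex whose realization contains `φ(X)`
            -- is all of `Σ`
            (∀ G : Finset (Finset (Fin m)), G ⊆ K.F →
              (∀ S ∈ G, ∀ T : Finset (Fin m), T ⊆ S → T.Nonempty → T ∈ G) →
              (∀ x : X, φ x ∈ ⋃ S ∈ G, simplexOf ε S) → G = K.F) ∧
            -- (3) `ψ ∘ φ` moves points at most `C·ε`
            (∀ x, ‖ι x - ψ (φ x)‖ ≤ (C : ℝ) * ε) := by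
  have hC : (0 : ℝ) < 4 * (n + 1) * (1 + 4 * c) := by positivity
  refine ⟨⟨_, hC.le⟩, hC, ?_⟩
  intro X _ _ _ ι hι hX ε hε
  obtain ⟨m, p, f, hf0, hfL, hfp, hfcard, hfε⟩ := hX.exists_bump_functions hc hε
  have hF : ∀ x, ε ≤ ∑ i, f i x := fun x =>
    (hfε x).elim fun i hi => hi.trans
      (Finset.single_le_sum (fun j _ => hf0 j x) (Finset.mem_univ i))
  have hFpos : ∀ x, 0 < ∑ i, f i x := fun x => hε.trans_le (hF x)
  let supp : X → Finset (Fin m) := fun x => Finset.univ.filter fun i => f i x ≠ 0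
  have hsupp : ∀ {x i}, i ∈ supp x ↔ f i x ≠ 0 := by simp [supp]
  have hne : ∀ x, (supp x).Nonempty := fun x =>
    (hfε x).elim fun i hi => ⟨i, hsupp.mpr (hε.trans_le hi).ne'⟩
  let t : X → Fin m → ℝ := fun x i => f i x / ∑ j, f j x
  have ht0 : ∀ x i, 0 ≤ t x i := fun x i => div_nonneg (hf0 i x) (hFpos x).le
  have ht1 : ∀ x, ∑ i, t x i = 1 := fun x => by
    rw [← Finset.sum_div, div_self (hFpos x).ne']
  have ht_ne : ∀ x i, t x i ≠ 0 → f i x ≠ 0 := fun x i h h0 => h (by simp [t, h0])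
  have ht_ne' : ∀ x i, f i x ≠ 0 → t x i ≠ 0 := fun x i h => div_ne_zero h (hFpos x).ne'
  have h2 : (1 : ℝ) ≤ Real.sqrt 2 := by rw [Real.one_le_sqrt]; norm_num
  have h2' : Real.sqrt 2 ≤ 2 := by rw [Real.sqrt_le_iff]; norm_num
  have hs2 : 0 < Real.sqrt 2 := by positivity
  have hscale : 0 < ε / Real.sqrt 2 := by positivity
  have hsc : ε / Real.sqrt 2 ≤ ε := div_le_self hε.le h2
  let φ : X → EuclideanSpace ℝ (Fin m) :=
    fun x => WithLp.toLp 2 fun i => ε / Real.sqrt 2 * t x i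
  let ψ : EuclideanSpace ℝ (Fin m) → Linf :=
    fun v => (Real.sqrt 2 / ε) • ∑ i, v i • ι (p i)
  have hφmem : ∀ x, φ x ∈ simplexOf ε (supp x) := fun x =>
    mem_simplexOf_of_weights ε _ _ (ht0 x)
      (fun i hi => by_contra fun h => hi (hsupp.mpr (ht_ne x i h))) (ht1 x)
  refine ⟨m, supportCplx supp hne, φ, ψ, ?_, ?_, ?_, ?_, ?_, ?_⟩
  · intro S hS
    obtain ⟨-, x, hx⟩ := mem_supportCplx.mp hS
    exact (Finset.card_le_card hx).trans (hfcard x)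
  · exact fun x => Set.mem_iUnion₂.mpr
      ⟨supp x, mem_supportCplx.mpr ⟨hne x, x, subset_rfl⟩, hφmem x⟩
  · refine LipschitzWith.of_dist_le_mul fun x y => ?_
    have h1 := sum_abs_div_sum_sub_le hε (fun i => hf0 i y) (hF x) (hF y)
    have h3 := sum_abs_sub_le_of_card_support_le hfL hfcard x y
    rw [dist_eq_norm]
    calc ‖φ x - φ y‖ ≤ ∑ i, |(φ x - φ y) i| := EuclideanSpace.norm_le_sum_abs _
      _ = ε / Real.sqrt 2 * ∑ i, |t x i - t y i| := by
          rw [Finset.mul_sum]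
          refine Finset.sum_congr rfl fun i _ => ?_
          simp only [φ, PiLp.sub_apply, ← mul_sub]
          rw [abs_mul, abs_of_pos hscale]
      _ ≤ ε * (2 * (2 * ((n + 1 : ℕ) : ℝ) * dist x y) / ε) := by
          refine mul_le_mul hsc (h1.trans ?_)
            (Finset.sum_nonneg fun i _ => abs_nonneg _) hε.le
          gcongr
      _ = 4 * (n + 1) * 1 * dist x y := by
          push_cast
          field_simp
          ring
      _ ≤ 4 * (n + 1) * (1 + 4 * c) * dist x y := by
          gcongr
          linarith
  · intro S hS
    obtain ⟨-, x, hx⟩ := mem_supportCplx.mp hS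
    have hcard : (S.card : ℝ) ≤ n + 1 := by
      exact_mod_cast (Finset.card_le_card hx).trans (hfcard x)
    refine LipschitzOnWith.of_dist_le_mul fun v hv w hw => ?_
    obtain ⟨hv0, hv1⟩ := apply_eq_zero_and_sum_of_mem_simplexOf hv
    obtain ⟨hw0, hw1⟩ := apply_eq_zero_and_sum_of_mem_simplexOf hw
    have hD : ∀ i ∈ S, ∀ j ∈ S, ‖ι (p i) - ι (p j)‖ ≤ 2 * ((1 + 4 * c) * ε) := by
      intro i hi j hj
      rw [← dist_eq_norm, hι.dist_eq]
      linarith [dist_triangle_left (p i) (p j) x, hfp i x (hsupp.mp (hx hi)),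
        hfp j x (hsupp.mp (hx hj))]
    have key := norm_sum_smul_le_of_sum_eq_zero (a := fun i => v i - w i) (M := dist v w)
      (fun i hi => by rw [hv0 i hi, hw0 i hi, sub_zero])
      (by rw [Finset.sum_sub_distrib, hv1, hw1, sub_self])
      (fun i => by simpa [dist_eq_norm] using PiLp.norm_apply_le (v - w) i) hD
    have hdiff : ψ v - ψ w = (Real.sqrt 2 / ε) • ∑ i, (v i - w i) • ι (p i) := by
      simp only [ψ, sub_smul, Finset.sum_sub_distrib, smul_sub]
    rw [dist_eq_norm, hdiff, norm_smul, Real.norm_of_nonneg (by positivity)]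
    calc Real.sqrt 2 / ε * ‖∑ i, (v i - w i) • ι (p i)‖
        ≤ 2 / ε * ((n + 1) * (dist v w * (2 * ((1 + 4 * c) * ε)))) := by
          refine mul_le_mul (by gcongr) (key.trans ?_) (norm_nonneg _) (by positivity)
          gcongr
      _ = 4 * (n + 1) * (1 + 4 * c) * dist v w := by
          field_simp
          ring
  · intro G hG hdown hmem
    refine subset_antisymm hG fun S hS => ?_
    obtain ⟨hSne, x, hx⟩ := mem_supportCplx.mp hS
    obtain ⟨T, hT, hxT⟩ := Set.mem_iUnion₂.mp (hmem x)
    refine hdown T hT S (fun i hi => by_contra fun hiT => ?_) hSne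
    have h0 := (apply_eq_zero_and_sum_of_mem_simplexOf hxT).1 i hiT
    exact mul_ne_zero hscale.ne' (ht_ne' x i (hsupp.mp (hx hi))) h0
  · intro x
    have hψφ : ψ (φ x) = ∑ i, t x i • ι (p i) := by
      simp only [ψ, φ, Finset.smul_sum, smul_smul]
      refine Finset.sum_congr rfl fun i _ => ?_
      congr 1
      field_simp
    rw [hψφ]
    have h := norm_sub_sum_smul_le (z := ι x) (q := fun i => ι (p i)) (ht0 x) (ht1 x)
      fun i hi => by
        rw [← dist_eq_norm, hι.dist_eq]
        exact hfp i x (ht_ne x i hi)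
    refine h.trans ?_
    change (1 + 4 * c) * ε ≤ 4 * (n + 1) * (1 + 4 * c) * ε
    have hn : (1 : ℝ) ≤ 4 * (n + 1) := by linarith [(Nat.cast_nonneg n : (0 : ℝ) ≤ n)]
    gcongr
    exact le_mul_of_one_le_left (by positivity) hn
end
end

section
/- Let Σ be a finite simplicial complex of dimension N equipped with the ℓ²-metric, and let μ₁, μ₂ be finite Borel measures on Σ whose supports are contained in a closed set K ⊆ Σ with finite Hausdorff n-measure, where n < N. Then there exists a map p : Σ → Σ that restricts to the identity on the (N−1)-skeleton of Σ and satisfies p(Δ) ⊆ Δ for every simplex Δ of Σ; moreover the restriction of p to K is Lipschitz, p(K) is contained in the (N−1)-skeleton Σ^{N−1}, and for i = 1, 2 and every simplex Δ of Σ one has ∫_{int Δ} (Lip(p)(x))^n dμ_i(x) ≤ C·μ_i(int Δ), where int Δ denotes the relative interior of Δ and the constant C > 0 depends only on N. -/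
open Set MeasureTheory Metric Filter
open scoped NNReal ENNReal Pointwise

noncomputable section

/-- The pointwise Lipschitz constant of `f` at `x`, relative to the set `A`:
`Lip(f)(x) = limsup_{y → x, y ∈ A} d(f(x), f(y)) / d(x, y)`. -/
def lipAt {E : Type*} [MetricSpace E] (f : E → E) (A : Set E) (x : E) : ℝ≥0∞ :=
  Filter.limsup (fun y => edist (f x) (f y) / edist x y) (nhdsWithin x (A \ {x}))

/-- Points of the standard simplex of size `c` with vertex set `S`, in coordinates. -/
def InSimplex {ι : Type*} [Fintype ι] (c : ℝ) (S : Finset ι) (x : EuclideanSpace ℝ ι) : Prop :=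
  (∀ i, 0 ≤ x i) ∧ (∀ i, i ∉ S → x i = 0) ∧ ∑ i, x i = c

/-- The Minkowski gauge, centred at `z`, of the simplex with vertex set `S`. -/
def faceGauge {ι : Type*} [Fintype ι] (S : Finset ι) (z x : EuclideanSpace ℝ ι) : ℝ :=
  ⨆ i : S, (1 - x i / z i)

/-- The radial projection from `z` onto the boundary of the simplex with vertex set `S`. -/
def radialProj {ι : Type*} [Fintype ι] (S : Finset ι) (z x : EuclideanSpace ℝ ι) :
    EuclideanSpace ℝ ι :=
  z + (faceGauge S z x)⁻¹ • (x - z)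

section Radial

variable {ι : Type*} [Fintype ι] {S : Finset ι} {c a : ℝ} {x y z : EuclideanSpace ℝ ι}

theorem euclidean_norm_le_sum_abs (x : EuclideanSpace ℝ ι) : ‖x‖ ≤ ∑ i, |x i| := by
  rw [EuclideanSpace.norm_eq]
  apply Real.sqrt_le_iff.2 ⟨Finset.sum_nonneg fun i _ => abs_nonneg _, ?_⟩
  simpa using Finset.sum_sq_le_sq_sum_of_nonneg (s := Finset.univ) (f := fun i => |x i|)
    (fun i _ => abs_nonneg _)

theorem abs_coord_sub_le_dist (x y : EuclideanSpace ℝ ι) (i : ι) : |x i - y i| ≤ dist x y := by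
  rw [dist_eq_norm]
  simpa using PiLp.norm_apply_le (x - y) i

theorem InSimplex.coord_le (hx : InSimplex c S x) (i : ι) : x i ≤ c := by
  rw [← hx.2.2]
  exact Finset.single_le_sum (fun j _ => hx.1 j) (Finset.mem_univ i)

theorem InSimplex.nonempty (hx : InSimplex c S x) (hc : 0 < c) : S.Nonempty := by
  by_contra h
  rw [Finset.not_nonempty_iff_eq_empty] at h
  have h0 : ∑ i, x i = 0 := Finset.sum_eq_zero fun i _ => hx.2.1 i (by simp [h])
  linarith [hx.2.2]

theorem le_faceGauge {i : ι} (hi : i ∈ S) : 1 - x i / z i ≤ faceGauge S z x :=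
  le_ciSup (f := fun i : S => 1 - x i / z i) (Finite.bddAbove_range _) ⟨i, hi⟩

theorem exists_eq_faceGauge (hS : S.Nonempty) : ∃ i ∈ S, 1 - x i / z i = faceGauge S z x := by
  have : Nonempty S := hS.to_subtype
  obtain ⟨i, hi⟩ := exists_eq_ciSup_of_finite (f := fun i : S => 1 - x i / z i)
  exact ⟨i, i.2, hi⟩

theorem mul_one_sub_faceGauge_le (hz : ∀ i ∈ S, 0 < z i) {i : ι} (hi : i ∈ S) :
    z i * (1 - faceGauge S z x) ≤ x i := by
  have h := le_faceGauge (x := x) (z := z) hi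
  have hzi := hz i hi
  have : z i * (1 - faceGauge S z x) ≤ z i * (x i / z i) := by gcongr; linarith
  rwa [mul_div_cancel₀ _ hzi.ne'] at this

theorem exists_mul_one_sub_faceGauge_eq (hS : S.Nonempty) (hz : ∀ i ∈ S, 0 < z i) :
    ∃ i ∈ S, z i * (1 - faceGauge S z x) = x i := by
  obtain ⟨i, hi, h⟩ := exists_eq_faceGauge (x := x) (z := z) hS
  refine ⟨i, hi, ?_⟩
  rw [← h]
  have := (hz i hi).ne'
  field_simp
  ring

theorem norm_sub_le_faceGauge (hx : InSimplex c S x) (hz : InSimplex c S z)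
    (hpos : ∀ i ∈ S, 0 < z i) (hc : 0 < c) : ‖x - z‖ ≤ 2 * c * faceGauge S z x := by
  set g := faceGauge S z x with hg
  have hu : ∀ i, 0 ≤ x i - z i * (1 - g) := by
    intro i
    by_cases hi : i ∈ S
    · linarith [mul_one_sub_faceGauge_le (x := x) hpos hi]
    · simp [hx.2.1 i hi, hz.2.1 i hi]
  have hsum : ∑ i, (x i - z i * (1 - g)) = c * g := by
    rw [Finset.sum_sub_distrib, ← Finset.sum_mul, hx.2.2, hz.2.2]; ring
  have hg0 : 0 ≤ g := by
    have : 0 ≤ c * g := hsum ▸ Finset.sum_nonneg fun i _ => hu i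
    exact nonneg_of_mul_nonneg_right this hc
  calc ‖x - z‖ ≤ ∑ i, |(x - z) i| := euclidean_norm_le_sum_abs _
    _ ≤ ∑ i, ((x i - z i * (1 - g)) + z i * g) := by
        refine Finset.sum_le_sum fun i _ => ?_
        rw [PiLp.sub_apply, abs_le]
        have := mul_nonneg (hz.1 i) hg0
        constructor <;> linarith [hu i]
    _ = 2 * c * g := by
        rw [Finset.sum_add_distrib, hsum, ← Finset.sum_mul, hz.2.2]; ring

theorem faceGauge_nonneg (hx : InSimplex c S x) (hz : InSimplex c S z)
    (hpos : ∀ i ∈ S, 0 < z i) (hc : 0 < c) : 0 ≤ faceGauge S z x := by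
  have h := (norm_nonneg _).trans (norm_sub_le_faceGauge hx hz hpos hc)
  exact nonneg_of_mul_nonneg_right h (by positivity)

theorem eq_of_faceGauge_eq_zero (hx : InSimplex c S x) (hz : InSimplex c S z)
    (hpos : ∀ i ∈ S, 0 < z i) (hc : 0 < c) (h : faceGauge S z x = 0) : x = z := by
  have h' := norm_sub_le_faceGauge hx hz hpos hc
  rw [h, mul_zero] at h'
  exact sub_eq_zero.1 (norm_le_zero_iff.1 h')

theorem faceGauge_le_one (hx : InSimplex c S x) (hz : InSimplex c S z)
    (hc : 0 < c) : faceGauge S z x ≤ 1 := by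
  have : Nonempty S := (hx.nonempty hc).to_subtype
  refine ciSup_le fun i => ?_
  linarith [div_nonneg (hx.1 i) (hz.1 i)]

theorem faceGauge_sub_le (hS : S.Nonempty) (ha : 0 < a) (hz : ∀ i ∈ S, a ≤ z i) :
    faceGauge S z x - faceGauge S z y ≤ dist x y / a := by
  obtain ⟨i, hi, h⟩ := exists_eq_faceGauge (x := x) (z := z) hS
  have h2 := le_faceGauge (x := y) (z := z) hi
  have hzi := hz i hi
  calc faceGauge S z x - faceGauge S z y ≤ (1 - x i / z i) - (1 - y i / z i) := by linarith
    _ = (y i - x i) / z i := by ring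
    _ ≤ dist x y / a := by
        gcongr
        have := abs_coord_sub_le_dist x y i
        rw [abs_le] at this
        linarith [this.1]

theorem radialProj_apply (i : ι) :
    radialProj S z x i = z i + (faceGauge S z x)⁻¹ * (x i - z i) := by
  simp [radialProj]

theorem radialProj_self : radialProj S z z = z := by simp [radialProj]

theorem inSimplex_radialProj (hx : InSimplex c S x) (hz : InSimplex c S z)
    (hpos : ∀ i ∈ S, 0 < z i) (hc : 0 < c) : InSimplex c S (radialProj S z x) := by
  have hg0 := faceGauge_nonneg hx hz hpos hc
  refine ⟨fun i => ?_, fun i hi => ?_, ?_⟩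
  · rw [radialProj_apply]
    by_cases hi : i ∈ S
    · rcases hg0.eq_or_lt with h | h
      · simp [← h, hz.1 i]
      · have h1 := mul_one_sub_faceGauge_le (x := x) hpos hi
        have h2 : (faceGauge S z x)⁻¹ * (-(faceGauge S z x * z i)) ≤
            (faceGauge S z x)⁻¹ * (x i - z i) := by
          gcongr
          linarith
        have h3 : (faceGauge S z x)⁻¹ * (-(faceGauge S z x * z i)) = - z i := by
          field_simp
        linarith
    · simp [hx.2.1 i hi, hz.2.1 i hi]
  · simp [radialProj_apply, hx.2.1 i hi, hz.2.1 i hi]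
  · simp only [radialProj_apply]
    rw [Finset.sum_add_distrib, ← Finset.mul_sum, Finset.sum_sub_distrib, hx.2.2, hz.2.2]
    simp

theorem exists_radialProj_apply_eq_zero (hx : InSimplex c S x) (hz : InSimplex c S z)
    (hpos : ∀ i ∈ S, 0 < z i) (hc : 0 < c) (hne : x ≠ z) :
    ∃ i ∈ S, radialProj S z x i = 0 := by
  have hg : faceGauge S z x ≠ 0 := fun h => hne (eq_of_faceGauge_eq_zero hx hz hpos hc h)
  obtain ⟨i, hi, h⟩ := exists_mul_one_sub_faceGauge_eq (x := x) (hx.nonempty hc) hpos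
  refine ⟨i, hi, ?_⟩
  rw [radialProj_apply, ← h]
  field_simp
  ring

theorem faceGauge_mul_dist_radialProj_le (hx : InSimplex c S x) (hy : InSimplex c S y)
    (hz : InSimplex c S z) (hc : 0 < c) (ha : 0 < a) (hza : ∀ i ∈ S, c * a ≤ z i) :
    faceGauge S z x * dist (radialProj S z x) (radialProj S z y) ≤ (1 + 2 / a) * dist x y := by
  have hpos : ∀ i ∈ S, 0 < z i := fun i hi => (mul_pos hc ha).trans_le (hza i hi)
  have hgx := faceGauge_nonneg hx hz hpos hc
  have hgy := faceGauge_nonneg hy hz hpos hc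
  have hS := hx.nonempty hc
  have hy2 : (faceGauge S z y)⁻¹ * ‖y - z‖ ≤ 2 * c := by
    rcases hgy.eq_or_lt with h | h
    · rw [← h]; simp; positivity
    · rw [inv_mul_le_iff₀ h]
      linarith [norm_sub_le_faceGauge hy hz hpos hc]
  have hlip : |faceGauge S z y - faceGauge S z x| ≤ dist x y / (c * a) := by
    rw [abs_le]
    have h1 := faceGauge_sub_le (x := x) (y := y) hS (mul_pos hc ha) hza
    have h2 := faceGauge_sub_le (x := y) (y := x) hS (mul_pos hc ha) hza
    rw [dist_comm] at h2
    constructor <;> linarith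
  have hxid : faceGauge S z x • (faceGauge S z x)⁻¹ • (x - z) = x - z := by
    rcases eq_or_ne (faceGauge S z x) 0 with h | h
    · rw [eq_of_faceGauge_eq_zero hx hz hpos hc h]; simp
    · rw [smul_inv_smul₀ h]
  have hyid : faceGauge S z y • (faceGauge S z y)⁻¹ • (y - z) = y - z := by
    rcases eq_or_ne (faceGauge S z y) 0 with h | h
    · rw [eq_of_faceGauge_eq_zero hy hz hpos hc h]; simp
    · rw [smul_inv_smul₀ h]
  have key : faceGauge S z x • (radialProj S z x - radialProj S z y) =
      (x - y) + (faceGauge S z y - faceGauge S z x) • ((faceGauge S z y)⁻¹ • (y - z)) := by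
    rw [sub_smul, hyid, radialProj, radialProj, add_sub_add_left_eq_sub, smul_sub, hxid]
    abel
  calc faceGauge S z x * dist (radialProj S z x) (radialProj S z y)
      = ‖faceGauge S z x • (radialProj S z x - radialProj S z y)‖ := by
        rw [norm_smul, Real.norm_of_nonneg hgx, dist_eq_norm]
    _ ≤ ‖x - y‖ + |faceGauge S z y - faceGauge S z x| * ((faceGauge S z y)⁻¹ * ‖y - z‖) := by
        rw [key]
        refine (norm_add_le _ _).trans (le_of_eq ?_)
        rw [norm_smul, norm_smul, Real.norm_eq_abs, Real.norm_of_nonneg (inv_nonneg.2 hgy)]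
    _ ≤ dist x y + dist x y / (c * a) * (2 * c) := by
        rw [← dist_eq_norm]
        gcongr
    _ = (1 + 2 / a) * dist x y := by field_simp

theorem dist_radialProj_self_le (hx : InSimplex c S x) (hz : InSimplex c S z)
    (hc : 0 < c) (ha : 0 < a) (hza : ∀ i ∈ S, c * a ≤ z i) {i : ι} (hi : i ∈ S) :
    dist (radialProj S z x) x ≤ 2 / a * x i := by
  have hpos : ∀ i ∈ S, 0 < z i := fun i hi => (mul_pos hc ha).trans_le (hza i hi)
  have hgx := faceGauge_nonneg hx hz hpos hc
  have hg1 := faceGauge_le_one hx hz hc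
  have hxi := hx.1 i
  rcases hgx.eq_or_lt with h | h
  · rw [eq_of_faceGauge_eq_zero hx hz hpos hc h.symm, radialProj_self, dist_self]
    have := hz.1 i
    positivity
  have hid : radialProj S z x - x = ((faceGauge S z x)⁻¹ * (1 - faceGauge S z x)) • (x - z) := by
    rw [mul_sub, inv_mul_cancel₀ h.ne', sub_smul, radialProj, mul_one, one_smul]
    abel
  have h1 : c * a * (1 - faceGauge S z x) ≤ x i :=
    (mul_le_mul_of_nonneg_right (hza i hi) (by linarith)).trans
      (mul_one_sub_faceGauge_le hpos hi)
  calc dist (radialProj S z x) x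
      = (faceGauge S z x)⁻¹ * (1 - faceGauge S z x) * ‖x - z‖ := by
        rw [dist_eq_norm, hid, norm_smul, Real.norm_of_nonneg]
        exact mul_nonneg (inv_nonneg.2 hgx) (by linarith)
    _ ≤ (faceGauge S z x)⁻¹ * (1 - faceGauge S z x) * (2 * c * faceGauge S z x) := by
        have : 0 ≤ 1 - faceGauge S z x := by linarith
        gcongr
        exact norm_sub_le_faceGauge hx hz hpos hc
    _ = 2 / a * (c * a * (1 - faceGauge S z x)) := by field_simp
    _ ≤ 2 / a * x i := by gcongr

end Radial

/-- The truncated Riesz kernel `‖v‖⁻ⁿ`, restricted to the closed unit ball. -/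
def truncKernel {E : Type*} [NormedAddCommGroup E] (n : ℕ) (v : E) : ℝ≥0∞ :=
  (closedBall (0 : E) 1).indicator (fun v => ‖v‖ₑ⁻¹ ^ n) v

theorem measurable_truncKernel {E : Type*} [NormedAddCommGroup E] [MeasurableSpace E]
    [BorelSpace E] (n : ℕ) : Measurable (truncKernel n : E → ℝ≥0∞) :=
  Measurable.indicator (by fun_prop) isClosed_closedBall.measurableSet

theorem lintegral_truncKernel_lt_top {N n : ℕ} (hn : n < N) :
    ∫⁻ v : Fin N → ℝ, truncKernel n v < ⊤ := by
  have : Nontrivial (Fin N → ℝ) := by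
    have : Nonempty (Fin N) := ⟨⟨n, hn⟩⟩
    infer_instance
  have hint : Integrable (fun v : Fin N → ℝ => (Iic (1 : ℝ)).indicator (fun r => (r ^ n)⁻¹) ‖v‖)
      volume := by
    rw [integrable_fun_norm_addHaar]
    have hfin : Module.finrank ℝ (Fin N → ℝ) = N := by simp
    rw [hfin]
    have hio : IntegrableOn (fun _ : ℝ => (1 : ℝ)) (Ioc 0 1) := by simp
    have : IntegrableOn ((Iic (1 : ℝ)).indicator (fun _ : ℝ => (1 : ℝ))) (Ioi 0) := by
      rw [IntegrableOn, integrable_indicator_iff measurableSet_Iic, IntegrableOn,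
        Measure.restrict_restrict measurableSet_Iic, inter_comm, Ioi_inter_Iic]
      exact hio
    refine Integrable.mono' this ?_ ?_
    · refine Measurable.aestronglyMeasurable ?_
      exact (by fun_prop : Measurable fun y : ℝ => y ^ (N - 1)).smul
        (Measurable.indicator (by fun_prop) measurableSet_Iic)
    · refine (ae_restrict_iff' measurableSet_Ioi).2 (ae_of_all _ fun y hy => ?_)
      have hy : 0 < y := hy
      by_cases h1 : y ≤ 1
      · rw [indicator_of_mem (by exact h1), indicator_of_mem (by exact h1), smul_eq_mul,
          Real.norm_of_nonneg (by positivity)]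
        rw [← div_eq_mul_inv, div_le_one (by positivity)]
        exact pow_le_pow_of_le_one hy.le h1 (by omega)
      · rw [indicator_of_notMem (by exact h1), indicator_of_notMem (by exact h1)]
        simp
  have h2 := hint.lintegral_lt_top
  refine lt_of_le_of_lt (lintegral_mono_ae ?_) h2
  have hne : ∀ᵐ v : Fin N → ℝ, v ≠ 0 := by
    simp [ae_iff, measure_singleton]
  filter_upwards [hne] with v hv
  have hv' : 0 < ‖v‖ := norm_pos_iff.2 hv
  by_cases h1 : ‖v‖ ≤ 1
  · rw [truncKernel, indicator_of_mem (by simpa using h1), indicator_of_mem (by exact h1),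
      ENNReal.ofReal_inv_of_pos (by positivity), ENNReal.ofReal_pow hv'.le, ofReal_norm,
      ENNReal.inv_pow]
  · rw [truncKernel, indicator_of_notMem (by simpa using h1)]
    simp

/-- Averaging over a box `W`: some parameter `w ∈ W` outside a given null set is good for
two finite measures simultaneously. -/
theorem exists_lintegral_truncKernel_le {N n : ℕ} {α : Type*} [MeasurableSpace α]
    {f : α → Fin N → ℝ} (hf : Measurable f) {W Z : Set (Fin N → ℝ)}
    (hWm : MeasurableSet W) (hW : volume W ≠ 0) (hW' : volume W ≠ ⊤) (hZ : volume Z = 0)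
    (ν₁ ν₂ : Measure α) [IsFiniteMeasure ν₁] [IsFiniteMeasure ν₂] :
    ∃ w ∈ W, w ∉ Z ∧
      ∫⁻ x, truncKernel n (f x - w) ∂ν₁ ≤
        2 * (∫⁻ v : Fin N → ℝ, truncKernel n v) / volume W * ν₁ univ ∧
      ∫⁻ x, truncKernel n (f x - w) ∂ν₂ ≤
        2 * (∫⁻ v : Fin N → ℝ, truncKernel n v) / volume W * ν₂ univ := by
  set I := ∫⁻ v : Fin N → ℝ, truncKernel n v with hI
  have hmeas : Measurable fun q : α × (Fin N → ℝ) => truncKernel n (f q.1 - q.2) :=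
    (measurable_truncKernel n).comp ((hf.comp measurable_fst).sub measurable_snd)
  have hmeas' (ν : Measure α) [IsFiniteMeasure ν] :
      Measurable fun w => ∫⁻ x, truncKernel n (f x - w) ∂ν :=
    Measurable.lintegral_prod_left' hmeas
  have hfub (ν : Measure α) [IsFiniteMeasure ν] :
      ∫⁻ w in W, (∫⁻ x, truncKernel n (f x - w) ∂ν) / ν univ ≤ I := by
    simp_rw [div_eq_mul_inv]
    rw [lintegral_mul_const _ (hmeas' ν), ← div_eq_mul_inv]
    refine ENNReal.div_le_of_le_mul ?_
    calc ∫⁻ w in W, (∫⁻ x, truncKernel n (f x - w) ∂ν)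
        ≤ ∫⁻ w, (∫⁻ x, truncKernel n (f x - w) ∂ν) := setLIntegral_le_lintegral _ _
      _ = ∫⁻ x, (∫⁻ w, truncKernel n (f x - w)) ∂ν := by
          rw [lintegral_lintegral_swap]
          exact (hmeas.comp measurable_swap).aemeasurable
      _ = ∫⁻ x, I ∂ν := by
          congr with x
          exact lintegral_sub_left_eq_self (truncKernel n) (f x)
      _ = I * ν univ := lintegral_const _
  have hmul (ν : Measure α) [IsFiniteMeasure ν] (w : Fin N → ℝ) (A : ℝ≥0∞)
      (h : (∫⁻ x, truncKernel n (f x - w) ∂ν) / ν univ ≤ A) :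
      ∫⁻ x, truncKernel n (f x - w) ∂ν ≤ A * ν univ := by
    rcases eq_or_ne (ν univ) 0 with h0 | h0
    · rw [Measure.measure_univ_eq_zero.1 h0]; simp
    · rwa [ENNReal.div_le_iff h0 (measure_ne_top _ _)] at h
  set h : (Fin N → ℝ) → ℝ≥0∞ := fun w =>
    (∫⁻ x, truncKernel n (f x - w) ∂ν₁) / ν₁ univ + (∫⁻ x, truncKernel n (f x - w) ∂ν₂) / ν₂ univ
  have hm : Measurable h := ((hmeas' ν₁).div_const _).add ((hmeas' ν₂).div_const _)
  have hnull : (volume.restrict W) (Z ∪ Wᶜ) = 0 := by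
    refine measure_union_null (le_antisymm ((Measure.restrict_apply_le _ _).trans hZ.le) zero_le) ?_
    rw [Measure.restrict_apply hWm.compl]; simp
  have : IsFiniteMeasure (volume.restrict W) := ⟨by simpa [lt_top_iff_ne_top] using hW'⟩
  obtain ⟨w, hw, hle⟩ := exists_notMem_null_le_laverage (μ := volume.restrict W) (f := h)
    (by rwa [Ne, Measure.restrict_eq_zero]) hm.aemeasurable hnull
  rw [mem_union, not_or, notMem_compl_iff] at hw
  have hbound : h w ≤ 2 * I / volume W := by
    refine hle.trans ?_
    rw [setLAverage_eq, lintegral_add_left ((hmeas' ν₁).div_const _), two_mul]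
    gcongr <;> exact hfub _
  exact ⟨w, hw.2, hw.1, hmul ν₁ w _ (le_self_add.trans hbound),
    hmul ν₂ w _ (le_add_self.trans hbound)⟩

/-- Barycentric coordinates (all but the zeroth) of admissible projection centres. -/
def centerBox (N : ℕ) : Set (Fin N → ℝ) :=
  Set.pi univ fun _ => Icc (1 / (2 * ((N : ℝ) + 1))) (1 / ((N : ℝ) + 1))

theorem volume_centerBox (N : ℕ) :
    volume (centerBox N) = ENNReal.ofReal (1 / (2 * ((N : ℝ) + 1))) ^ N := by
  rw [centerBox, volume_pi_pi]
  simp only [Real.volume_Icc, Finset.prod_const, Finset.card_univ, Fintype.card_fin]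
  congr 2
  field_simp
  norm_num

theorem volume_centerBox_ne_zero (N : ℕ) : volume (centerBox N) ≠ 0 := by
  rw [volume_centerBox]
  refine pow_ne_zero _ (ENNReal.ofReal_pos.2 (by positivity)).ne'

theorem volume_centerBox_ne_top (N : ℕ) : volume (centerBox N) ≠ ⊤ := by
  rw [volume_centerBox]
  exact ENNReal.pow_ne_top ENNReal.ofReal_ne_top

/-- The constant in the averaged kernel estimate for projection centres. -/
def centerConst (N n : ℕ) : ℝ≥0∞ :=
  2 * (∫⁻ v : Fin N → ℝ, truncKernel n v) / volume (centerBox N)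

theorem centerConst_ne_top {N n : ℕ} (hn : n < N) : centerConst N n ≠ ⊤ :=
  ENNReal.div_ne_top (ENNReal.mul_ne_top (by simp) (lintegral_truncKernel_lt_top hn).ne)
    (volume_centerBox_ne_zero N)

theorem exists_embedding_of_card_eq {ι : Type*} {k : ℕ} {S : Finset ι} (hS : S.card = k) :
    ∃ e : Fin k → ι, Function.Injective e ∧ (∀ j, e j ∈ S) ∧ ∀ i ∈ S, ∃ j, e j = i := by
  let q := S.equivFinOfCardEq hS
  exact ⟨fun j => q.symm j, Subtype.val_injective.comp q.symm.injective, fun j => (q.symm j).2,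
    fun i hi => ⟨q ⟨i, hi⟩, by simp⟩⟩

theorem exists_inSimplex_of_weights {ι : Type*} [Fintype ι] {k : ℕ} {S : Finset ι}
    {e : Fin k → ι} (he : Function.Injective e) (heS : ∀ j, e j ∈ S)
    (hsurj : ∀ i ∈ S, ∃ j, e j = i) (v : Fin k → ℝ) (hv : ∀ j, 0 ≤ v j) :
    ∃ z : EuclideanSpace ℝ ι, InSimplex (∑ j, v j) S z ∧ ∀ j, z (e j) = v j := by
  classical
  have h1 : ∀ j, Function.extend e v (0 : ι → ℝ) (e j) = v j := fun j => he.extend_apply v _ j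
  have h2 : ∀ i, i ∉ S → Function.extend e v (0 : ι → ℝ) i = 0 := fun i hi =>
    Function.extend_apply' v (0 : ι → ℝ) i fun ⟨j, hj⟩ => hi (hj ▸ heS j)
  refine ⟨WithLp.toLp 2 (Function.extend e v (0 : ι → ℝ)), ⟨fun i => ?_, h2, ?_⟩, h1⟩
  · by_cases hi : i ∈ S
    · obtain ⟨j, rfl⟩ := hsurj i hi
      simpa [h1] using hv j
    · exact (h2 i hi).ge
  · symm
    refine Finset.sum_of_injOn e he.injOn (by simp) (fun i _ hi => ?_) fun j _ => (h1 j).symm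
    refine h2 i fun hiS => hi ?_
    obtain ⟨j, rfl⟩ := hsurj i hiS
    simp

theorem exists_good_center {N n m : ℕ} (hn : n < N) {S : Finset (Fin m)} (hS : S.card = N + 1)
    {c : ℝ} (hc : 0 < c) (μ₁ μ₂ : Measure (EuclideanSpace ℝ (Fin m)))
    [IsFiniteMeasure μ₁] [IsFiniteMeasure μ₂] {A K : Set (EuclideanSpace ℝ (Fin m))}
    (hA : ∀ x ∈ A, InSimplex c S x) (hK : μH[(n : ℝ)] K < ⊤) :
    ∃ z : EuclideanSpace ℝ (Fin m), InSimplex c S z ∧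
      (∀ i ∈ S, c * (1 / (2 * ((N : ℝ) + 1))) ≤ z i) ∧ z ∉ K ∧
      ∫⁻ x in A, (ENNReal.ofReal c * ‖x - z‖ₑ⁻¹) ^ n ∂μ₁ ≤ centerConst N n * μ₁ A ∧
      ∫⁻ x in A, (ENNReal.ofReal c * ‖x - z‖ₑ⁻¹) ^ n ∂μ₂ ≤ centerConst N n * μ₂ A := by
  obtain ⟨e, he, heS, hsurj⟩ := exists_embedding_of_card_eq hS
  set f : EuclideanSpace ℝ (Fin m) → Fin N → ℝ := fun x j => x (e j.succ) / c with hf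
  have hfm : Measurable f := by
    refine measurable_pi_lambda _ fun j => ?_
    have : Continuous fun x : EuclideanSpace ℝ (Fin m) => x (e j.succ) / c := by fun_prop
    exact this.measurable
  have hdist (x y) : dist (f x) (f y) ≤ c⁻¹ * dist x y := by
    refine (dist_pi_le_iff (by positivity)).2 fun j => ?_
    rw [Real.dist_eq, hf, ← sub_div, abs_div, abs_of_pos hc, div_eq_inv_mul]
    gcongr
    exact abs_coord_sub_le_dist x y _
  have hZ : volume (f '' K) = 0 := by
    have h0 : μH[(N : ℝ)] K = 0 :=
      (Measure.hausdorffMeasure_zero_or_top (Nat.cast_lt.2 hn) K).resolve_right hK.ne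
    have hlip : LipschitzWith ⟨c⁻¹, by positivity⟩ f := LipschitzWith.of_dist_le_mul hdist
    have h1 := hlip.hausdorffMeasure_image_le (d := N) (by positivity) K
    rw [h0, mul_zero] at h1
    have h2 := hausdorffMeasure_pi_real (ι := Fin N)
    rw [Fintype.card_fin] at h2
    rw [← h2]
    exact le_antisymm h1 zero_le
  obtain ⟨w, hwW, hwZ, hw1, hw2⟩ := exists_lintegral_truncKernel_le (n := n) (W := centerBox N) hfm
    (MeasurableSet.univ_pi fun _ => measurableSet_Icc) (volume_centerBox_ne_zero N)
    (volume_centerBox_ne_top N) hZ (μ₁.restrict A) (μ₂.restrict A)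
  have hw (j) : 1 / (2 * ((N : ℝ) + 1)) ≤ w j ∧ w j ≤ 1 / ((N : ℝ) + 1) := hwW j (mem_univ j)
  have hsum : ∑ j, w j ≤ N / ((N : ℝ) + 1) := by
    refine (Finset.sum_le_sum fun j _ => (hw j).2).trans (le_of_eq ?_)
    simp [div_eq_mul_inv]
  have hN : (N : ℝ) / (N + 1) = 1 - 1 / (N + 1) := by field_simp; ring
  have hhalf : 1 / (2 * ((N : ℝ) + 1)) ≤ 1 / ((N : ℝ) + 1) := by
    gcongr
    linarith [(Nat.cast_nonneg N : (0 : ℝ) ≤ N)]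
  set v : Fin (N + 1) → ℝ := Fin.cons (c * (1 - ∑ j, w j)) (fun j => c * w j) with hv
  have hva (j) : c * (1 / (2 * ((N : ℝ) + 1))) ≤ v j := by
    refine Fin.cases ?_ (fun j => ?_) j
    · rw [hv, Fin.cons_zero]
      gcongr
      linarith
    · rw [hv, Fin.cons_succ]
      gcongr
      exact (hw j).1
  have hvsum : ∑ j, v j = c := by
    rw [Fin.sum_univ_succ]
    simp only [hv, Fin.cons_zero, Fin.cons_succ]
    rw [← Finset.mul_sum]
    ring
  obtain ⟨z, hz, hze⟩ := exists_inSimplex_of_weights he heS hsurj v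
    fun j => le_trans (by positivity) (hva j)
  rw [hvsum] at hz
  have hfz : f z = w := by
    ext j
    simp [hf, hze, hv, hc.ne']
  have hkernel (x) (hx : x ∈ A) :
      (ENNReal.ofReal c * ‖x - z‖ₑ⁻¹) ^ n ≤ truncKernel n (f x - w) := by
    have h1 : ‖f x - w‖ ≤ 1 := by
      refine (pi_norm_le_iff_of_nonneg zero_le_one).2 fun j => ?_
      have h1 : f x j ≤ 1 := div_le_one_of_le₀ ((hA x hx).coord_le _) hc.le
      have h2 : 0 ≤ f x j := div_nonneg ((hA x hx).1 _) hc.le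
      have h3 : w j ≤ 1 := (hw j).2.trans (by
        rw [div_le_one (by positivity)]; linarith [(Nat.cast_nonneg N : (0 : ℝ) ≤ N)])
      have h4 : 0 ≤ w j := le_trans (by positivity) (hw j).1
      rw [Pi.sub_apply, Real.norm_eq_abs, abs_le]
      constructor <;> linarith
    rw [truncKernel, indicator_of_mem (by simpa using h1)]
    gcongr
    have h2 := hdist x z
    rw [hfz, dist_eq_norm, dist_eq_norm] at h2
    have h3 : ‖f x - w‖ₑ ≤ (ENNReal.ofReal c)⁻¹ * ‖x - z‖ₑ := by
      rw [← ENNReal.ofReal_inv_of_pos hc, ← ofReal_norm, ← ofReal_norm,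
        ← ENNReal.ofReal_mul (by positivity)]
      exact ENNReal.ofReal_le_ofReal h2
    refine le_trans (le_of_eq ?_) (ENNReal.inv_le_inv.2 h3)
    rw [ENNReal.mul_inv (Or.inl (by simp)) (Or.inl (by simp [hc])), inv_inv]
  have hkm : Measurable fun x => truncKernel n (f x - w) :=
    (measurable_truncKernel n).comp (hfm.sub_const w)
  refine ⟨z, hz, fun i hi => ?_, fun hzK => hwZ ⟨z, hzK, hfz⟩, ?_, ?_⟩
  · obtain ⟨j, rfl⟩ := hsurj i hi
    rw [hze]
    exact hva j
  · refine (setLIntegral_mono hkm hkernel).trans (hw1.trans (le_of_eq ?_))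
    rw [Measure.restrict_apply_univ, centerConst]
  · refine (setLIntegral_mono hkm hkernel).trans (hw2.trans (le_of_eq ?_))
    rw [Measure.restrict_apply_univ, centerConst]

section Retraction

variable {ι : Type*} [Fintype ι]

/-- The set of indices of the nonzero coordinates of a point. -/
def coordSupport (x : EuclideanSpace ℝ ι) : Finset ι := Finset.univ.filter fun i => x i ≠ 0

theorem mem_coordSupport {x : EuclideanSpace ℝ ι} {i : ι} : i ∈ coordSupport x ↔ x i ≠ 0 := by
  simp [coordSupport]

theorem InSimplex.coordSupport_subset {c : ℝ} {S : Finset ι} {x : EuclideanSpace ℝ ι}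
    (hx : InSimplex c S x) : coordSupport x ⊆ S := fun i hi => by
  by_contra h
  exact mem_coordSupport.1 hi (hx.2.1 i h)

theorem InSimplex.inSimplex_coordSupport {c : ℝ} {S : Finset ι} {x : EuclideanSpace ℝ ι}
    (hx : InSimplex c S x) : InSimplex c (coordSupport x) x :=
  ⟨hx.1, fun i hi => by simpa [mem_coordSupport] using hi, hx.2.2⟩

theorem convex_setOf_inSimplex (c : ℝ) (S : Finset ι) :
    Convex ℝ {x : EuclideanSpace ℝ ι | InSimplex c S x} := by
  intro x hx y hy a b ha hb hab
  refine ⟨fun i => ?_, fun i hi => ?_, ?_⟩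
  · simpa using add_nonneg (mul_nonneg ha (hx.1 i)) (mul_nonneg hb (hy.1 i))
  · simp [hx.2.1 i hi, hy.2.1 i hi]
  · simp only [PiLp.add_apply, PiLp.smul_apply, smul_eq_mul]
    rw [Finset.sum_add_distrib, ← Finset.mul_sum, ← Finset.mul_sum, hx.2.2, hy.2.2, ← add_mul,
      hab, one_mul]

theorem InSimplex.smul {c r : ℝ} {S : Finset ι} {x : EuclideanSpace ℝ ι} (hr : 0 ≤ r) (hx : InSimplex c S x) :
    InSimplex (r * c) S (r • x) := by
  refine ⟨fun i => ?_, fun i hi => ?_, ?_⟩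
  · simpa using mul_nonneg hr (hx.1 i)
  · simp [hx.2.1 i hi]
  · simp only [PiLp.smul_apply, smul_eq_mul]
    rw [← Finset.mul_sum, hx.2.2]

theorem InSimplex.mono {c : ℝ} {S T : Finset ι} {x : EuclideanSpace ℝ ι}
    (hx : InSimplex c S x) (h : S ⊆ T) : InSimplex c T x :=
  ⟨hx.1, fun i hi => hx.2.1 i fun h' => hi (h h'), hx.2.2⟩

/-- Radial projection from `z T` inside the open simplex on each `T` with `N + 1` vertices,
and the identity at all points whose support does not have `N + 1` elements. -/
def radialRetraction (N : ℕ) (z : Finset ι → EuclideanSpace ℝ ι) (x : EuclideanSpace ℝ ι) :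
    EuclideanSpace ℝ ι :=
  if (coordSupport x).card = N + 1 then radialProj (coordSupport x) (z (coordSupport x)) x else x

variable {N : ℕ} {z : Finset ι → EuclideanSpace ℝ ι} {c a : ℝ} {x y : EuclideanSpace ℝ ι}

theorem radialRetraction_of_card_ne (h : (coordSupport x).card ≠ N + 1) :
    radialRetraction N z x = x := if_neg h

theorem radialRetraction_of_card_eq (h : (coordSupport x).card = N + 1) :
    radialRetraction N z x = radialProj (coordSupport x) (z (coordSupport x)) x := if_pos h

theorem dist_radialRetraction_self_le (hc : 0 < c) (ha : 0 < a)
    (hz : ∀ T : Finset ι, T.card = N + 1 → InSimplex c T (z T) ∧ ∀ i ∈ T, c * a ≤ z T i)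
    (hx : InSimplex c (coordSupport x) x) (hy : (coordSupport y).card ≤ N + 1)
    (hne : coordSupport x ≠ coordSupport y) :
    dist (radialRetraction N z x) x ≤ 2 / a * dist x y := by
  by_cases h : (coordSupport x).card = N + 1
  · rw [radialRetraction_of_card_eq h]
    obtain ⟨i, hi, hiy⟩ : ∃ i ∈ coordSupport x, i ∉ coordSupport y := by
      by_contra! hsub
      exact hne (Finset.eq_of_subset_of_card_le hsub (by omega))
    refine (dist_radialProj_self_le hx (hz _ h).1 hc ha (hz _ h).2 hi).trans ?_
    have hyi : y i = 0 := by simpa [mem_coordSupport] using hiy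
    have := abs_coord_sub_le_dist x y i
    rw [hyi, sub_zero] at this
    gcongr
    exact (le_abs_self _).trans this
  · rw [radialRetraction_of_card_ne h, dist_self]
    positivity

theorem dist_radialRetraction_le_of_ne (hc : 0 < c) (ha : 0 < a)
    (hz : ∀ T : Finset ι, T.card = N + 1 → InSimplex c T (z T) ∧ ∀ i ∈ T, c * a ≤ z T i)
    (hx : InSimplex c (coordSupport x) x) (hy : InSimplex c (coordSupport y) y)
    (hxc : (coordSupport x).card ≤ N + 1) (hyc : (coordSupport y).card ≤ N + 1)
    (hne : coordSupport x ≠ coordSupport y) :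
    dist (radialRetraction N z x) (radialRetraction N z y) ≤ (1 + 4 / a) * dist x y := by
  have h1 := dist_radialRetraction_self_le hc ha hz hx hyc hne
  have h2 := dist_radialRetraction_self_le hc ha hz hy hxc hne.symm
  rw [dist_comm y x, dist_comm _ y] at h2
  have h3 := dist_triangle4 (radialRetraction N z x) x y (radialRetraction N z y)
  calc dist (radialRetraction N z x) (radialRetraction N z y)
      ≤ 2 / a * dist x y + dist x y + 2 / a * dist x y := by linarith
    _ = (1 + 4 / a) * dist x y := by ring

theorem dist_radialRetraction_le_of_card_ne (hc : 0 < c) (ha : 0 < a)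
    (hz : ∀ T : Finset ι, T.card = N + 1 → InSimplex c T (z T) ∧ ∀ i ∈ T, c * a ≤ z T i)
    (hx : InSimplex c (coordSupport x) x) (hy : InSimplex c (coordSupport y) y)
    (hxc : (coordSupport x).card ≤ N + 1) (hyc : (coordSupport y).card ≤ N + 1)
    (h : (coordSupport x).card ≠ N + 1) :
    dist (radialRetraction N z x) (radialRetraction N z y) ≤ (1 + 4 / a) * dist x y := by
  by_cases hne : coordSupport x = coordSupport y
  · rw [radialRetraction_of_card_ne h, radialRetraction_of_card_ne (hne ▸ h)]
    have : 0 ≤ 4 / a * dist x y := by positivity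
    linarith
  · exact dist_radialRetraction_le_of_ne hc ha hz hx hy hxc hyc hne

theorem norm_sub_mul_dist_radialRetraction_le (hc : 0 < c) (ha : 0 < a)
    (hz : ∀ T : Finset ι, T.card = N + 1 → InSimplex c T (z T) ∧ ∀ i ∈ T, c * a ≤ z T i)
    (hx : InSimplex c (coordSupport x) x) (hy : InSimplex c (coordSupport y) y)
    (hyc : (coordSupport y).card ≤ N + 1) (h : (coordSupport x).card = N + 1) :
    ‖x - z (coordSupport x)‖ * dist (radialRetraction N z x) (radialRetraction N z y) ≤
      2 * (1 + 4 / a) * c * dist x y := by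
  obtain ⟨hzx, hza⟩ := hz _ h
  have hpos : ∀ i ∈ coordSupport x, 0 < z (coordSupport x) i :=
    fun i hi => (mul_pos hc ha).trans_le (hza i hi)
  have hnorm := norm_sub_le_faceGauge hx hzx hpos hc
  have key : faceGauge (coordSupport x) (z (coordSupport x)) x *
      dist (radialRetraction N z x) (radialRetraction N z y) ≤ (1 + 4 / a) * dist x y := by
    by_cases hne : coordSupport x = coordSupport y
    · rw [radialRetraction_of_card_eq h, radialRetraction_of_card_eq (hne ▸ h), ← hne]
      refine (faceGauge_mul_dist_radialProj_le hx (hne ▸ hy) hzx hc ha hza).trans ?_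
      gcongr
      norm_num
    · refine (mul_le_of_le_one_left dist_nonneg (faceGauge_le_one hx hzx hc)).trans ?_
      exact dist_radialRetraction_le_of_ne hc ha hz hx hy h.le hyc hne
  calc ‖x - z (coordSupport x)‖ * dist (radialRetraction N z x) (radialRetraction N z y)
      ≤ 2 * c * faceGauge (coordSupport x) (z (coordSupport x)) x *
          dist (radialRetraction N z x) (radialRetraction N z y) := by gcongr
    _ = 2 * c * (faceGauge (coordSupport x) (z (coordSupport x)) x *
          dist (radialRetraction N z x) (radialRetraction N z y)) := by ring
    _ ≤ 2 * c * ((1 + 4 / a) * dist x y) := by gcongr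
    _ = 2 * (1 + 4 / a) * c * dist x y := by ring

theorem inSimplex_radialRetraction (hc : 0 < c) (ha : 0 < a)
    (hz : ∀ T : Finset ι, T.card = N + 1 → InSimplex c T (z T) ∧ ∀ i ∈ T, c * a ≤ z T i)
    {S : Finset ι} (hx : InSimplex c S x) : InSimplex c S (radialRetraction N z x) := by
  by_cases h : (coordSupport x).card = N + 1
  · rw [radialRetraction_of_card_eq h]
    exact (inSimplex_radialProj hx.inSimplex_coordSupport (hz _ h).1
      (fun i hi => (mul_pos hc ha).trans_le ((hz _ h).2 i hi)) hc).mono hx.coordSupport_subset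
  · rwa [radialRetraction_of_card_ne h]

theorem lipAt_le_of_forall {E : Type*} [MetricSpace E] {f : E → E} {A : Set E} {x : E} {M : ℝ≥0∞}
    (h : ∀ y ∈ A, edist (f x) (f y) ≤ M * edist x y) : lipAt f A x ≤ M := by
  refine limsup_le_of_le (by isBoundedDefault) ?_
  filter_upwards [self_mem_nhdsWithin] with y hy
  exact ENNReal.div_le_of_le_mul (h y hy.1)

theorem edist_le_of_dist_le {E : Type*} [MetricSpace E] {u v x y : E} {M : ℝ} (hM : 0 ≤ M)
    (h : dist u v ≤ M * dist x y) : edist u v ≤ ENNReal.ofReal M * edist x y := by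
  rw [edist_dist, edist_dist, ← ENNReal.ofReal_mul hM]
  exact ENNReal.ofReal_le_ofReal h

theorem lipAt_radialRetraction_le (hc : 0 < c) (ha : 0 < a)
    (hz : ∀ T : Finset ι, T.card = N + 1 → InSimplex c T (z T) ∧ ∀ i ∈ T, c * a ≤ z T i)
    {A : Set (EuclideanSpace ℝ ι)}
    (hA : ∀ y ∈ A, InSimplex c (coordSupport y) y ∧ (coordSupport y).card ≤ N + 1)
    (hx : InSimplex c (coordSupport x) x) (h : (coordSupport x).card = N + 1) :
    lipAt (radialRetraction N z) A x ≤ ENNReal.ofReal (2 * (1 + 4 / a)) *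
      (ENNReal.ofReal c * ‖x - z (coordSupport x)‖ₑ⁻¹) := by
  have hB : 0 < 2 * (1 + 4 / a) := by positivity
  rcases eq_or_ne x (z (coordSupport x)) with hxz | hxz
  · have h0 : ‖x - z (coordSupport x)‖ₑ = 0 := by rw [enorm_eq_zero, sub_eq_zero]; exact hxz
    rw [h0, ENNReal.inv_zero, ENNReal.mul_top (ENNReal.ofReal_pos.2 hc).ne',
      ENNReal.mul_top (ENNReal.ofReal_pos.2 hB).ne']
    exact le_top
  · have hr : 0 < ‖x - z (coordSupport x)‖ := norm_pos_iff.2 (sub_ne_zero.2 hxz)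
    rw [← ofReal_norm, ← ENNReal.ofReal_inv_of_pos hr, ← ENNReal.ofReal_mul hc.le,
      ← ENNReal.ofReal_mul hB.le]
    refine lipAt_le_of_forall fun y hy => edist_le_of_dist_le (by positivity) ?_
    have := norm_sub_mul_dist_radialRetraction_le hc ha hz hx (hA y hy).1 (hA y hy).2 h
    rw [← le_div_iff₀' hr] at this
    refine this.trans (le_of_eq ?_)
    ring

theorem lipAt_radialRetraction_le_of_card_ne (hc : 0 < c) (ha : 0 < a)
    (hz : ∀ T : Finset ι, T.card = N + 1 → InSimplex c T (z T) ∧ ∀ i ∈ T, c * a ≤ z T i)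
    {A : Set (EuclideanSpace ℝ ι)}
    (hA : ∀ y ∈ A, InSimplex c (coordSupport y) y ∧ (coordSupport y).card ≤ N + 1)
    (hx : InSimplex c (coordSupport x) x) (hxc : (coordSupport x).card ≤ N + 1)
    (h : (coordSupport x).card ≠ N + 1) :
    lipAt (radialRetraction N z) A x ≤ ENNReal.ofReal (1 + 4 / a) :=
  lipAt_le_of_forall fun y hy => edist_le_of_dist_le (by positivity)
    (dist_radialRetraction_le_of_card_ne hc ha hz hx (hA y hy).1 hxc (hA y hy).2 h)

theorem exists_lipschitzOnWith_radialRetraction (hc : 0 < c) (ha : 0 < a)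
    (hz : ∀ T : Finset ι, T.card = N + 1 → InSimplex c T (z T) ∧ ∀ i ∈ T, c * a ≤ z T i)
    {K : Set (EuclideanSpace ℝ ι)} (hK : IsClosed K)
    (hKA : ∀ y ∈ K, InSimplex c (coordSupport y) y ∧ (coordSupport y).card ≤ N + 1)
    (hzK : ∀ T : Finset ι, T.card = N + 1 → z T ∉ K) :
    ∃ L : ℝ≥0, LipschitzOnWith L (radialRetraction N z) K := by
  have hδ (T : Finset ι) : ∃ δ : ℝ, 0 < δ ∧ (T.card = N + 1 → ∀ x ∈ K, δ ≤ ‖x - z T‖) := by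
    by_cases hT : T.card = N + 1
    · obtain ⟨δ, hδ, hball⟩ := Metric.isOpen_iff.1 hK.isOpen_compl (z T) (hzK T hT)
      refine ⟨δ, hδ, fun _ x hx => ?_⟩
      by_contra! hlt
      exact hball (by rwa [mem_ball, dist_eq_norm]) hx
    · exact ⟨1, one_pos, fun h => absurd h hT⟩
  choose δ hδ hδK using hδ
  obtain ⟨M, hM⟩ := Finite.bddAbove_range fun T => 2 * (1 + 4 / a) * c / δ T
  refine ⟨(max M (1 + 4 / a)).toNNReal, LipschitzOnWith.of_dist_le_mul fun x hx y hy => ?_⟩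
  rw [Real.coe_toNNReal _ (le_max_of_le_right (by positivity))]
  obtain ⟨hx1, hxc⟩ := hKA x hx
  obtain ⟨hy1, hyc⟩ := hKA y hy
  by_cases h : (coordSupport x).card = N + 1
  · have h1 := norm_sub_mul_dist_radialRetraction_le hc ha hz hx1 hy1 hyc h
    have h2 : δ (coordSupport x) * dist (radialRetraction N z x) (radialRetraction N z y) ≤
        2 * (1 + 4 / a) * c * dist x y :=
      (mul_le_mul_of_nonneg_right (hδK _ h x hx) dist_nonneg).trans h1
    rw [← le_div_iff₀' (hδ _)] at h2
    calc dist (radialRetraction N z x) (radialRetraction N z y)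
        ≤ 2 * (1 + 4 / a) * c / δ (coordSupport x) * dist x y := h2.trans (le_of_eq (by ring))
      _ ≤ max M (1 + 4 / a) * dist x y := by
          gcongr
          exact le_max_of_le_left (hM ⟨_, rfl⟩)
  · refine (dist_radialRetraction_le_of_card_ne hc ha hz hx1 hy1 hxc hyc h).trans ?_
    gcongr
    exact le_max_right _ _

end Retraction

section Realization

variable {ι : Type*} [Fintype ι] [DecidableEq ι] {s : ℝ} {S : Finset ι}
  {x : EuclideanSpace ℝ ι}

theorem inSimplex_vertex {i : ι} (hi : i ∈ S) : InSimplex 1 S (vertex i) := by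
  refine ⟨fun j => ?_, fun j hj => ?_, ?_⟩
  · by_cases h : j = i <;> simp [vertex, h]
  · have : j ≠ i := fun h => hj (h ▸ hi)
    simp [vertex, this]
  · simp [vertex]

theorem sum_smul_vertex_apply (t : ι → ℝ) (i : ι) :
    (∑ j ∈ S, t j • (vertex j : EuclideanSpace ℝ ι)) i = if i ∈ S then t i else 0 := by
  simp [vertex, Finset.sum_apply, Pi.single_apply]

theorem mem_simplexOf_iff (hs : 0 < s) :
    x ∈ simplexOf s S ↔ InSimplex (s / Real.sqrt 2) S x := by
  have hc : 0 < s / Real.sqrt 2 := by positivity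
  rw [simplexOf, mem_smul_set_iff_inv_smul_mem₀ hc.ne']
  constructor
  · intro h
    have h1 : InSimplex 1 S ((s / Real.sqrt 2)⁻¹ • x) := by
      refine convexHull_min ?_ (convex_setOf_inSimplex 1 S) h
      rintro _ ⟨i, hi, rfl⟩
      exact inSimplex_vertex hi
    have h2 := h1.smul hc.le
    rwa [smul_inv_smul₀ hc.ne', mul_one] at h2
  · intro h
    have h1 := h.smul (inv_nonneg.2 hc.le)
    rw [inv_mul_cancel₀ hc.ne'] at h1
    set y := (s / Real.sqrt 2)⁻¹ • x
    have hy : y = ∑ i ∈ S, y i • vertex i := by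
      ext i
      rw [sum_smul_vertex_apply]
      split_ifs with hi
      · rfl
      · exact h1.2.1 i hi
    rw [hy]
    refine (convex_convexHull ℝ _).sum_mem (fun i _ => h1.1 i) ?_
      fun i hi => subset_convexHull ℝ _ ⟨i, hi, rfl⟩
    rw [← h1.2.2]
    exact Finset.sum_subset (Finset.subset_univ _) fun i _ hi => h1.2.1 i hi

theorem coordSupport_of_mem_openSimplexOf (hs : 0 < s) (hx : x ∈ openSimplexOf s S) :
    InSimplex (s / Real.sqrt 2) S x ∧ coordSupport x = S := by
  have hc : 0 < s / Real.sqrt 2 := by positivity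
  obtain ⟨t, ht, hsum, rfl⟩ := hx
  have h1 : InSimplex 1 S (∑ i ∈ S, t i • (vertex i : EuclideanSpace ℝ ι)) :=
    (convex_setOf_inSimplex 1 S).sum_mem (fun i hi => (ht i hi).le) hsum
      fun i hi => inSimplex_vertex hi
  refine ⟨by simpa using h1.smul hc.le, ?_⟩
  ext i
  rw [mem_coordSupport, PiLp.smul_apply, sum_smul_vertex_apply, smul_eq_mul, mul_ne_zero_iff]
  by_cases hi : i ∈ S
  · simp [hi, hc.ne', (ht i hi).ne']
  · simp [hi]

theorem coordSupport_mem_of_mem_realization (K : SimplicialCplx ι) (hs : 0 < s)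
    (hx : x ∈ realization s K) :
    coordSupport x ∈ K.F ∧ InSimplex (s / Real.sqrt 2) (coordSupport x) x := by
  obtain ⟨S, hS, hxS⟩ := mem_iUnion₂.1 hx
  rw [mem_simplexOf_iff hs] at hxS
  exact ⟨K.down_closed S hS _ hxS.coordSupport_subset
    (hxS.inSimplex_coordSupport.nonempty (by positivity)), hxS.inSimplex_coordSupport⟩

theorem mem_skeleton_iff {K : SimplicialCplx ι} {k : ℕ} :
    x ∈ skeleton s K k ↔ ∃ S ∈ K.F, S.card ≤ k + 1 ∧ x ∈ simplexOf s S := by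
  simp only [skeleton, mem_iUnion, exists_prop]

theorem radialRetraction_mem_skeleton {N : ℕ} {K : SimplicialCplx ι} (hN : 0 < N) {a : ℝ}
    (hs : 0 < s) (ha : 0 < a) {z : Finset ι → EuclideanSpace ℝ ι}
    (hz : ∀ T : Finset ι, T.card = N + 1 →
      InSimplex (s / Real.sqrt 2) T (z T) ∧ ∀ i ∈ T, s / Real.sqrt 2 * a ≤ z T i)
    (hxF : coordSupport x ∈ K.F) (hx : InSimplex (s / Real.sqrt 2) (coordSupport x) x)
    (hxc : (coordSupport x).card ≤ N + 1)
    (hxz : (coordSupport x).card = N + 1 → x ≠ z (coordSupport x)) :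
    radialRetraction N z x ∈ skeleton s K (N - 1) := by
  have hc : 0 < s / Real.sqrt 2 := by positivity
  rw [mem_skeleton_iff]
  by_cases h : (coordSupport x).card = N + 1
  · have hp := inSimplex_radialRetraction hc ha hz hx
    obtain ⟨i, hi, hi0⟩ := exists_radialProj_apply_eq_zero hx (hz _ h).1
      (fun i hi => (mul_pos hc ha).trans_le ((hz _ h).2 i hi)) hc (hxz h)
    rw [← radialRetraction_of_card_eq h] at hi0
    set q := radialRetraction N z x
    have hsub : coordSupport q ⊆ coordSupport x := hp.coordSupport_subset
    have hcard : (coordSupport q).card < (coordSupport x).card := by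
      refine Finset.card_lt_card (Finset.ssubset_iff_subset_ne.2 ⟨hsub, fun heq => ?_⟩)
      rw [← heq, mem_coordSupport] at hi
      exact hi hi0
    exact ⟨coordSupport q, K.down_closed _ hxF _ hsub (hp.inSimplex_coordSupport.nonempty hc),
      by omega, (mem_simplexOf_iff hs).2 hp.inSimplex_coordSupport⟩
  · rw [radialRetraction_of_card_ne h]
    exact ⟨_, hxF, by omega, (mem_simplexOf_iff hs).2 hx⟩

end Realization

/-- The constant in the integral estimate for radial retractions. -/
def retractionConst (N : ℕ) : ℝ≥0 :=
  ∑ n ∈ Finset.range N, (Real.toNNReal (2 * (1 + 4 / (1 / (2 * ((N : ℝ) + 1)))))) ^ n *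
    ((centerConst N n).toNNReal + 1) + 1

theorem pow_mul_centerConst_le {N n : ℕ} (hn : n < N) :
    ENNReal.ofReal (2 * (1 + 4 / (1 / (2 * ((N : ℝ) + 1))))) ^ n * (centerConst N n + 1) ≤
      retractionConst N := by
  have h := (Finset.single_le_sum
    (f := fun n => (Real.toNNReal (2 * (1 + 4 / (1 / (2 * ((N : ℝ) + 1)))))) ^ n *
      ((centerConst N n).toNNReal + 1))
    (fun _ _ => zero_le) (Finset.mem_range.2 hn)).trans (le_self_add (b := 1))
  change _ ≤ retractionConst N at h
  have h2 := ENNReal.coe_le_coe.2 h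
  push_cast at h2
  rwa [ENNReal.coe_toNNReal (centerConst_ne_top hn)] at h2

theorem setLIntegral_lipAt_radialRetraction_le {N n m : ℕ} (hn : n < N) {s : ℝ} (hs : 0 < s)
    {z : Finset (Fin m) → EuclideanSpace ℝ (Fin m)}
    (hz : ∀ T : Finset (Fin m), T.card = N + 1 → InSimplex (s / Real.sqrt 2) T (z T) ∧
      ∀ i ∈ T, s / Real.sqrt 2 * (1 / (2 * ((N : ℝ) + 1))) ≤ z T i)
    {A : Set (EuclideanSpace ℝ (Fin m))}
    (hA : ∀ y ∈ A, InSimplex (s / Real.sqrt 2) (coordSupport y) y ∧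
      (coordSupport y).card ≤ N + 1)
    {S : Finset (Fin m)} (hS : S.card ≤ N + 1) (μ : Measure (EuclideanSpace ℝ (Fin m)))
    (hμ : S.card = N + 1 → ∫⁻ x in openSimplexOf s S,
      (ENNReal.ofReal (s / Real.sqrt 2) * ‖x - z S‖ₑ⁻¹) ^ n ∂μ ≤
        centerConst N n * μ (openSimplexOf s S)) :
    ∫⁻ x in openSimplexOf s S, (lipAt (radialRetraction N z) A x) ^ n ∂μ ≤
      retractionConst N * μ (openSimplexOf s S) := by
  have hc : 0 < s / Real.sqrt 2 := by positivity
  have ha : (0 : ℝ) < 1 / (2 * ((N : ℝ) + 1)) := by positivity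
  have hconst := pow_mul_centerConst_le hn
  set a : ℝ := 1 / (2 * ((N : ℝ) + 1))
  by_cases h : S.card = N + 1
  · calc ∫⁻ x in openSimplexOf s S, (lipAt (radialRetraction N z) A x) ^ n ∂μ
        ≤ ∫⁻ x in openSimplexOf s S, ENNReal.ofReal (2 * (1 + 4 / a)) ^ n *
          (ENNReal.ofReal (s / Real.sqrt 2) * ‖x - z S‖ₑ⁻¹) ^ n ∂μ := by
          refine setLIntegral_mono (by fun_prop) fun x hx => ?_
          obtain ⟨hxS, hsupp⟩ := coordSupport_of_mem_openSimplexOf hs hx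
          rw [← mul_pow]
          gcongr
          have := lipAt_radialRetraction_le hc ha hz hA hxS.inSimplex_coordSupport (hsupp ▸ h)
          rwa [hsupp] at this
      _ = ENNReal.ofReal (2 * (1 + 4 / a)) ^ n * ∫⁻ x in openSimplexOf s S,
          (ENNReal.ofReal (s / Real.sqrt 2) * ‖x - z S‖ₑ⁻¹) ^ n ∂μ :=
          lintegral_const_mul' _ _ (ENNReal.pow_ne_top ENNReal.ofReal_ne_top)
      _ ≤ ENNReal.ofReal (2 * (1 + 4 / a)) ^ n *
          ((centerConst N n + 1) * μ (openSimplexOf s S)) := by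
          gcongr
          refine (hμ h).trans ?_
          gcongr
          exact le_self_add
      _ ≤ retractionConst N * μ (openSimplexOf s S) := by
          rw [← mul_assoc]
          gcongr
  · calc ∫⁻ x in openSimplexOf s S, (lipAt (radialRetraction N z) A x) ^ n ∂μ
        ≤ ∫⁻ x in openSimplexOf s S, ENNReal.ofReal (2 * (1 + 4 / a)) ^ n ∂μ := by
          refine setLIntegral_mono measurable_const fun x hx => ?_
          obtain ⟨hxS, hsupp⟩ := coordSupport_of_mem_openSimplexOf hs hx
          gcongr
          refine (lipAt_radialRetraction_le_of_card_ne hc ha hz hA hxS.inSimplex_coordSupport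
            (hsupp ▸ hS) (hsupp ▸ h)).trans (ENNReal.ofReal_le_ofReal ?_)
          have : 0 < 1 + 4 / a := by positivity
          linarith
      _ ≤ retractionConst N * μ (openSimplexOf s S) := by
          rw [setLIntegral_const]
          gcongr
          refine le_trans ?_ hconst
          exact le_mul_of_one_le_right zero_le le_add_self

/-- (A deformation/radial projection lemma.)
Let `Σ` be a finite simplicial complex of dimension `N` with the `ℓ²`-metric, and let
`μ₁, μ₂` be finite Borel measures supported in a closed set `K ⊆ Σ` of finite Hausdorff
`n`-measure, `n < N`. Then there is a map `p : Σ → Σ` fixing the `(N−1)`-skeleton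
pointwise, with `p(Δ) ⊆ Δ` for every simplex `Δ`, whose restriction to `K` is Lipschitz,
with `p(K) ⊆ Σ^{N−1}`, and such that for `i = 1, 2` and each simplex `Δ`,
`∫_{int Δ} Lip(p)(x)^n dμ_i ≤ C·μ_i(int Δ)` with `C` depending only on `N`. -/
theorem stmt2 (N : ℕ) :
    ∃ C : ℝ≥0, 0 < C ∧
      ∀ (n : ℕ), n < N →
      ∀ (m : ℕ) (K : SimplicialCplx (Fin m)) (s : ℝ), 0 < s →
        -- `Σ` has dimension `N`
        (∀ S ∈ K.F, S.card ≤ N + 1) → (∃ S ∈ K.F, S.card = N + 1) →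
        ∀ (μ₁ μ₂ : Measure (EuclideanSpace ℝ (Fin m))) (Kc : Set (EuclideanSpace ℝ (Fin m))),
          IsFiniteMeasure μ₁ → IsFiniteMeasure μ₂ →
          IsClosed Kc → Kc ⊆ realization s K →
          μH[(n : ℝ)] Kc < ⊤ →
          -- `μ₁, μ₂` are supported in `Kc`
          μ₁ Kcᶜ = 0 → μ₂ Kcᶜ = 0 →
          ∃ p : EuclideanSpace ℝ (Fin m) → EuclideanSpace ℝ (Fin m),
            -- `p` is the identity on the `(N−1)`-skeleton
            (∀ x ∈ skeleton s K (N - 1), p x = x) ∧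
            -- `p(Δ) ⊆ Δ` for every simplex of `Σ`
            (∀ S ∈ K.F, ∀ x ∈ simplexOf s S, p x ∈ simplexOf s S) ∧
            -- `p` restricted to `Kc` is Lipschitz
            (∃ L : ℝ≥0, LipschitzOnWith L p Kc) ∧
            -- `p(Kc)` lies in the `(N−1)`-skeleton
            (p '' Kc ⊆ skeleton s K (N - 1)) ∧
            -- the integral bounds on relative interiors of simplices
            (∀ S ∈ K.F,
              ∫⁻ x in openSimplexOf s S, (lipAt p (realization s K) x) ^ n ∂μ₁ ≤
                (C : ℝ≥0∞) * μ₁ (openSimplexOf s S)) ∧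
            (∀ S ∈ K.F,
              ∫⁻ x in openSimplexOf s S, (lipAt p (realization s K) x) ^ n ∂μ₂ ≤
                (C : ℝ≥0∞) * μ₂ (openSimplexOf s S)) := by
  refine ⟨retractionConst N, by simp [retractionConst], ?_⟩
  intro n hn m K s hs hdim _ μ₁ μ₂ Kc hμ₁ hμ₂ hKc hKsub hKfin _ _
  have hc : 0 < s / Real.sqrt 2 := by positivity
  have ha : (0 : ℝ) < 1 / (2 * ((N : ℝ) + 1)) := by positivity
  have hcenter (T : Finset (Fin m)) := fun hT : T.card = N + 1 =>
    exists_good_center hn hT hc μ₁ μ₂ (A := openSimplexOf s T) (K := Kc)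
      (fun x hx => (coordSupport_of_mem_openSimplexOf hs hx).1) hKfin
  choose! z hz using hcenter
  have hz1 := fun T hT => And.intro (hz T hT).1 (hz T hT).2.1
  have hA : ∀ y ∈ realization s K, InSimplex (s / Real.sqrt 2) (coordSupport y) y ∧
      (coordSupport y).card ≤ N + 1 := fun y hy =>
    ⟨(coordSupport_mem_of_mem_realization K hs hy).2,
      hdim _ (coordSupport_mem_of_mem_realization K hs hy).1⟩
  refine ⟨radialRetraction N z, fun x hx => ?_, fun S _ x hx => ?_, ?_, ?_, fun S hS => ?_,
    fun S hS => ?_⟩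
  · obtain ⟨S, _, hcard, hxS⟩ := mem_skeleton_iff.1 hx
    have hle := Finset.card_le_card ((mem_simplexOf_iff hs).1 hxS).coordSupport_subset
    exact radialRetraction_of_card_ne (by omega)
  · rw [mem_simplexOf_iff hs] at hx ⊢
    exact inSimplex_radialRetraction hc ha hz1 hx
  · exact exists_lipschitzOnWith_radialRetraction hc ha hz1 hKc (fun y hy => hA y (hKsub hy))
      fun T hT => (hz T hT).2.2.1
  · rintro _ ⟨x, hx, rfl⟩
    obtain ⟨hxF, hxS⟩ := coordSupport_mem_of_mem_realization K hs (hKsub hx)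
    exact radialRetraction_mem_skeleton (by omega) hs ha hz1 hxF hxS (hdim _ hxF)
      fun hT hxz => (hz _ hT).2.2.1 (hxz ▸ hx)
  · exact setLIntegral_lipAt_radialRetraction_le hn hs hz1 hA (hdim S hS) μ₁
      fun hT => (hz S hT).2.2.2.1
  · exact setLIntegral_lipAt_radialRetraction_le hn hs hz1 hA (hdim S hS) μ₂
      fun hT => (hz S hT).2.2.2.2
end
end
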